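/- For q ∈ L¹([0,π]; ℝ): if α = π and β = 0 (Dirichlet conditions), the n-th eigenfunction of L(q,α,β) has exactly n+2 zeros in [0,π] (including both endpoints); if exactly one of the conditions α = π or β = 0 holds (with the other parameter in the open interval (0,π)), the n-th eigenfunction has exactly n+1 zeros in [0,π]; otherwise it has exactly n zeros in [0,π]. -/

import Mathlib

open Real MeasureTheory Set

noncomputable section

/-- `y` (with derivative `y'`) is a (Carathéodory) solution of `-y'' + q y = μ y` on `[0, π]`,
written in integral form. -/
def SLSol (q : ℝ → ℝ) (μ : ℝ) (y y' : ℝ → ℝ) : Prop :=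
  ContinuousOn y (Icc 0 π) ∧ ContinuousOn y' (Icc 0 π) ∧
  (∀ x ∈ Icc (0:ℝ) π, y x = y 0 + ∫ t in (0:ℝ)..x, y' t) ∧
  (∀ x ∈ Icc (0:ℝ) π, y' x = y' 0 + ∫ t in (0:ℝ)..x, (q t - μ) * y t)

/-- `y` (with derivative `y'`) solves the inhomogeneous equation `-y'' + q y = g + μ y`
(equivalently `y'' = (q - μ) y - g`) on `[0, π]`, in integral form.  With `g` the original
solution, this is the equation satisfied by the `μ`-derivative of a solution. -/
def SLSolInh (q : ℝ → ℝ) (μ : ℝ) (g y y' : ℝ → ℝ) : Prop :=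
  ContinuousOn y (Icc 0 π) ∧ ContinuousOn y' (Icc 0 π) ∧
  (∀ x ∈ Icc (0:ℝ) π, y x = y 0 + ∫ t in (0:ℝ)..x, y' t) ∧
  (∀ x ∈ Icc (0:ℝ) π, y' x = y' 0 + ∫ t in (0:ℝ)..x, ((q t - μ) * y t - g t))

/-- `y` (with derivative `y'`) is an eigenfunction of the Sturm–Liouville problem
`L(q, α, β)` with eigenvalue `μ`. -/
def IsEigenpair (q : ℝ → ℝ) (α β μ : ℝ) (y y' : ℝ → ℝ) : Prop :=
  SLSol q μ y y' ∧ (∃ x ∈ Icc (0:ℝ) π, y x ≠ 0) ∧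
  y 0 * Real.cos α + y' 0 * Real.sin α = 0 ∧
  y π * Real.cos β + y' π * Real.sin β = 0

/-- `μ` is an eigenvalue of the Sturm–Liouville problem `L(q, α, β)`. -/
def IsEigenvalue (q : ℝ → ℝ) (α β μ : ℝ) : Prop :=
  ∃ y y', IsEigenpair q α β μ y y'

/-- On `[0, b]` the function `F` is an indefinite integral of the integrable function `f`. -/
def IsPrimitive (b : ℝ) (f F : ℝ → ℝ) : Prop :=
  IntervalIntegrable f volume 0 b ∧ ∀ x ∈ Icc 0 b, F x = F 0 + ∫ t in (0:ℝ)..x, f t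

theorem AbsolutelyContinuousOnInterval.lipschitzOnWith_comp {φ F : ℝ → ℝ} {a b : ℝ} {s : Set ℝ}
    {K : NNReal} (hF : AbsolutelyContinuousOnInterval F a b) (hφ : LipschitzOnWith K φ s)
    (hs : ∀ x ∈ uIcc a b, F x ∈ s) :
    AbsolutelyContinuousOnInterval (fun x => φ (F x)) a b := by
  unfold AbsolutelyContinuousOnInterval at hF ⊢
  refine squeeze_zero' (Filter.Eventually.of_forall fun _ =>
    Finset.sum_nonneg fun i _ => dist_nonneg) ?_ (by simpa using hF.const_mul (K : ℝ))
  rw [Filter.eventually_inf_principal]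
  filter_upwards with E hE
  rw [Finset.mul_sum]
  refine Finset.sum_le_sum fun i hi => ?_
  exact hφ.dist_le_mul _ (hs _ (hE.1 i hi).1) _ (hs _ (hE.1 i hi).2)

theorem isPrimitive_of_absolutelyContinuous {b : ℝ} (hb : 0 ≤ b) {f F : ℝ → ℝ}
    (hF : AbsolutelyContinuousOnInterval F 0 b)
    (hf : ∀ᵐ x, x ∈ uIcc 0 b → HasDerivAt F (f x) x) : IsPrimitive b f F := by
  refine ⟨hF.intervalIntegrable_deriv.congr_ae ?_, fun x hx => ?_⟩
  · rw [Filter.EventuallyEq, ae_restrict_iff' measurableSet_uIoc]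
    filter_upwards [hf] with x h hx
    exact (h (uIoc_subset_uIcc hx)).deriv
  · have hsub : uIcc 0 x ⊆ uIcc 0 b := by
      rw [uIcc_of_le hx.1, uIcc_of_le hb]
      exact Icc_subset_Icc_right hx.2
    have h1 := (hF.mono hsub).integral_deriv_eq_sub
    have h2 : ∫ t in (0:ℝ)..x, deriv F t = ∫ t in (0:ℝ)..x, f t := by
      apply intervalIntegral.integral_congr_ae
      filter_upwards [hf] with t h ht
      exact (h (hsub (uIoc_subset_uIcc ht))).deriv
    linarith

namespace IsPrimitive

variable {b : ℝ} {f g F G : ℝ → ℝ}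

theorem exists_absolutelyContinuous (hF : IsPrimitive b f F) :
    ∃ H : ℝ → ℝ, AbsolutelyContinuousOnInterval H 0 b ∧ EqOn F H (Icc 0 b) ∧
      ∀ᵐ x, x ∈ uIcc 0 b → HasDerivAt H (f x) x := by
  refine ⟨fun x => F 0 + ∫ t in (0:ℝ)..x, f t, ?_, fun x hx => hF.2 x hx, ?_⟩
  · have h0 : AbsolutelyContinuousOnInterval (fun _ : ℝ => F 0) 0 b :=
      (LipschitzWith.const (F 0)).lipschitzOnWith.absolutelyContinuousOnInterval
    exact h0.add (hF.1.absolutelyContinuousOnInterval_intervalIntegral (by simp))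
  · filter_upwards [hF.1.ae_hasDerivAt_integral] with x h hx
    exact (h hx 0 (by simp)).const_add _

theorem congr (hb : 0 ≤ b) (hF : IsPrimitive b f F) (hfg : EqOn f g (Icc 0 b))
    (hFG : EqOn F G (Icc 0 b)) : IsPrimitive b g G := by
  refine ⟨hF.1.congr fun t ht => hfg ?_, fun x hx => ?_⟩
  · rw [uIoc_of_le hb] at ht
    exact Ioc_subset_Icc_self ht
  · rw [← hFG hx, ← hFG ⟨le_rfl, hb⟩, hF.2 x hx]
    congr 1
    apply intervalIntegral.integral_congr
    intro t ht
    rw [uIcc_of_le hx.1] at ht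
    exact hfg ⟨ht.1, ht.2.trans hx.2⟩

theorem continuousOn (hb : 0 ≤ b) (hF : IsPrimitive b f F) : ContinuousOn F (Icc 0 b) := by
  obtain ⟨H, hH, hFH, -⟩ := hF.exists_absolutelyContinuous
  have := hH.continuousOn
  rw [uIcc_of_le hb] at this
  exact this.congr hFH

theorem sub_eq_integral (hF : IsPrimitive b f F) {x z : ℝ} (hx : x ∈ Icc 0 b)
    (hz : z ∈ Icc 0 b) : F z - F x = ∫ t in x..z, f t := by
  have h0 : (0:ℝ) ∈ uIcc 0 b := left_mem_uIcc
  have hx' : x ∈ uIcc 0 b := Icc_subset_uIcc hx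
  have hz' : z ∈ uIcc 0 b := Icc_subset_uIcc hz
  rw [hF.2 x hx, hF.2 z hz, ← intervalIntegral.integral_interval_sub_left
    (hF.1.mono_set (uIcc_subset_uIcc h0 hz')) (hF.1.mono_set (uIcc_subset_uIcc h0 hx'))]
  ring

theorem of_integral (hf : IntervalIntegrable f volume 0 b) (c : ℝ) :
    IsPrimitive b f (fun x => c + ∫ t in (0:ℝ)..x, f t) :=
  ⟨hf, fun x _ => by simp⟩

theorem mul (hb : 0 ≤ b) (hF : IsPrimitive b f F) (hG : IsPrimitive b g G) :
    IsPrimitive b (fun x => f x * G x + F x * g x) (fun x => F x * G x) := by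
  obtain ⟨H, hH, hFH, hH'⟩ := hF.exists_absolutelyContinuous
  obtain ⟨I, hI, hGI, hI'⟩ := hG.exists_absolutelyContinuous
  have h : IsPrimitive b (fun x => f x * I x + H x * g x) (fun x => H x * I x) := by
    refine isPrimitive_of_absolutelyContinuous hb (hH.fun_mul hI) ?_
    filter_upwards [hH', hI'] with x h1 h2 hx
    exact (h1 hx).mul (h2 hx)
  exact h.congr hb (fun x hx => by simp [hFH hx, hGI hx]) (fun x hx => by simp [hFH hx, hGI hx])

theorem comp (hb : 0 ≤ b) (hF : IsPrimitive b f F) {φ φ' : ℝ → ℝ}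
    (hφ : ∀ x, HasDerivAt φ (φ' x) x) (hφ' : Continuous φ') :
    IsPrimitive b (fun x => φ' (F x) * f x) (fun x => φ (F x)) := by
  obtain ⟨H, hH, hFH, hH'⟩ := hF.exists_absolutelyContinuous
  obtain ⟨C, hC⟩ := hH.exists_bound
  have hcd : ContDiff ℝ 1 φ := by
    rw [contDiff_one_iff_deriv]
    refine ⟨fun x => (hφ x).differentiableAt, ?_⟩
    rwa [show deriv φ = φ' from funext fun x => (hφ x).deriv]
  obtain ⟨K, hK⟩ := (hcd.contDiffOn (s := Icc (-C) C)).exists_lipschitzOnWith (by decide)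
    (convex_Icc _ _) isCompact_Icc
  have h : IsPrimitive b (fun x => φ' (H x) * f x) (fun x => φ (H x)) := by
    refine isPrimitive_of_absolutelyContinuous hb
      (hH.lipschitzOnWith_comp hK fun x hx => abs_le.1 (hC x hx)) ?_
    filter_upwards [hH'] with x h1 hx
    exact (hφ (H x)).comp x (h1 hx)
  exact h.congr hb (fun x hx => by simp [hFH hx]) (fun x hx => by simp [hFH hx])

theorem add (hb : 0 ≤ b) (hF : IsPrimitive b f F) (hG : IsPrimitive b g G) :
    IsPrimitive b (fun x => f x + g x) (fun x => F x + G x) := by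
  obtain ⟨H, hH, hFH, hH'⟩ := hF.exists_absolutelyContinuous
  obtain ⟨I, hI, hGI, hI'⟩ := hG.exists_absolutelyContinuous
  have h : IsPrimitive b (fun x => f x + g x) (fun x => H x + I x) := by
    refine isPrimitive_of_absolutelyContinuous hb (hH.add hI) ?_
    filter_upwards [hH', hI'] with x h1 h2 hx
    exact (h1 hx).add (h2 hx)
  exact h.congr hb (fun x _ => rfl) (fun x hx => by simp [hFH hx, hGI hx])

theorem sub (hb : 0 ≤ b) (hF : IsPrimitive b f F) (hG : IsPrimitive b g G) :
    IsPrimitive b (fun x => f x - g x) (fun x => F x - G x) := by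
  have h := hF.add hb (hG.comp hb (φ := fun x => -x) (φ' := fun _ => -1)
    (fun x => (hasDerivAt_id x).neg) continuous_const)
  exact h.congr hb (fun x _ => by simp [sub_eq_add_neg]) (fun x _ => by simp [sub_eq_add_neg])

/-- Variation of constants for the scalar linear equation `F' = c F + g`. -/
theorem mul_exp_neg_integral (hb : 0 ≤ b) {c : ℝ → ℝ} (hc : IntervalIntegrable c volume 0 b)
    (hF : IsPrimitive b (fun x => c x * F x + g x) F) :
    IsPrimitive b (fun x => g x * exp (-∫ t in (0:ℝ)..x, c t))
      (fun x => F x * exp (-∫ t in (0:ℝ)..x, c t)) := by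
  have hE := (of_integral hc 0).comp hb (φ := fun x => exp (-x)) (φ' := fun x => -exp (-x))
    (fun x => by simpa using (hasDerivAt_id x).neg.exp) (by fun_prop)
  refine (hF.mul hb hE).congr hb (fun x _ => ?_) (fun x _ => ?_)
  · simp only [zero_add]; ring
  · simp

/-- The homogeneous equation `F' = c F`. -/
theorem eq_mul_exp_integral (hb : 0 ≤ b) {c : ℝ → ℝ} (hc : IntervalIntegrable c volume 0 b)
    (hF : IsPrimitive b (fun x => c x * F x) F) {x : ℝ} (hx : x ∈ Icc 0 b) :
    F x = F 0 * exp (∫ t in (0:ℝ)..x, c t) := by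
  have h := mul_exp_neg_integral (g := fun _ => 0) hb hc
    (hF.congr hb (fun x _ => by simp) (fun x _ => rfl))
  have := h.2 x hx
  simp only [zero_mul, intervalIntegral.integral_zero, intervalIntegral.integral_same, neg_zero,
    exp_zero, mul_one, add_zero] at this
  rw [← this, mul_assoc, ← exp_add]
  simp

end IsPrimitive

theorem abs_sin_sq_sub_sin_sq_le (a b : ℝ) : |sin a ^ 2 - sin b ^ 2| ≤ |a - b| := by
  have h : sin a ^ 2 - sin b ^ 2 = sin (a - b) * sin (a + b) := by
    rw [sin_sub, sin_add]
    linear_combination sin b ^ 2 * sin_sq_add_cos_sq a - sin a ^ 2 * sin_sq_add_cos_sq b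
  rw [h, abs_mul]
  calc |sin (a - b)| * |sin (a + b)| ≤ |a - b| * 1 :=
        mul_le_mul abs_sin_le_abs (abs_sin_le_one _) (abs_nonneg _) (abs_nonneg _)
    _ = |a - b| := mul_one _

/-- `θ` solves the Prüfer equation `θ' = 1 + p sin² θ` on `[0, b]`; for `p = μ - q - 1` this is
`θ' = cos² θ + (μ - q) sin² θ`. -/
def IsPruferAngle (b : ℝ) (p θ : ℝ → ℝ) : Prop :=
  IsPrimitive b (fun x => 1 + p x * sin (θ x) ^ 2) θ

theorem exists_isPruferAngle {b : ℝ} (hb : 0 ≤ b) {p : ℝ → ℝ}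
    (hp : IntervalIntegrable p volume 0 b) (θ₀ : ℝ) : ∃ θ, θ 0 = θ₀ ∧ IsPruferAngle b p θ := by
  set W : ℝ → ℝ := fun x => ∫ t in (0:ℝ)..x, |p t| with hW
  have hWp : IsPrimitive b (fun t => |p t|) W := by
    simpa [hW] using IsPrimitive.of_integral hp.abs 0
  have hWc := hWp.continuousOn hb
  have hEp : IsPrimitive b (fun t => (2 * exp (2 * W t)) * |p t|) (fun t => exp (2 * W t)) :=
    hWp.comp hb (φ := fun x => exp (2 * x)) (φ' := fun x => 2 * exp (2 * x))
      (fun x => by simpa [mul_comm] using ((hasDerivAt_id x).const_mul 2).exp) (by fun_prop)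
  have hEc : ContinuousOn (fun t => exp (2 * W t)) (uIcc 0 b) := by
    rw [uIcc_of_le hb]; exact hEp.continuousOn hb
  have hint : ∀ φ : C(Icc 0 b, ℝ), IntervalIntegrable
      (fun t => 1 + p t * sin (exp (2 * W t) * IccExtend hb φ t) ^ 2) volume 0 b := by
    intro φ
    refine intervalIntegrable_const.add (hp.mul_continuousOn ?_)
    exact (continuous_sin.comp_continuousOn
      (hEc.mul (φ.continuous.Icc_extend' (h := hb)).continuousOn)).pow 2
  set I : C(Icc 0 b, ℝ) → ℝ → ℝ := fun φ x =>
    θ₀ + ∫ t in (0:ℝ)..x, (1 + p t * sin (exp (2 * W t) * IccExtend hb φ t) ^ 2) with hI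
  have hIp : ∀ φ : C(Icc 0 b, ℝ), IsPrimitive b
      (fun t => 1 + p t * sin (exp (2 * W t) * IccExtend hb φ t) ^ 2) (I φ) := fun φ =>
    IsPrimitive.of_integral (hint φ) θ₀
  have hcont : ∀ φ : C(Icc 0 b, ℝ), ContinuousOn (fun x => exp (-(2 * W x)) * I φ x) (Icc 0 b) := fun φ =>
    ((continuousOn_const.mul hWc).neg.rexp).mul ((hIp φ).continuousOn hb)
  let S : C(Icc 0 b, ℝ) → C(Icc 0 b, ℝ) := fun φ =>
    ⟨fun x => exp (-(2 * W x)) * I φ x, (hcont φ).comp_continuous continuous_subtype_val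
      fun x => x.2⟩
  have hS : ContractingWith (1 / 2) S := by
    refine ⟨by norm_num, LipschitzWith.of_dist_le_mul fun φ ψ => ?_⟩
    rw [ContinuousMap.dist_le (by positivity)]
    rintro ⟨x, hx⟩
    have hsub : uIcc 0 x ⊆ uIcc 0 b := by
      rw [uIcc_of_le hx.1, uIcc_of_le hb]; exact Icc_subset_Icc_right hx.2
    have hd : |I φ x - I ψ x| ≤ ∫ t in (0:ℝ)..x, (2 * exp (2 * W t) * |p t|) * (dist φ ψ / 2) := by
      have : I φ x - I ψ x = ∫ t in (0:ℝ)..x,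
          ((1 + p t * sin (exp (2 * W t) * IccExtend hb φ t) ^ 2)
            - (1 + p t * sin (exp (2 * W t) * IccExtend hb ψ t) ^ 2)) := by
        rw [intervalIntegral.integral_sub ((hint φ).mono_set hsub) ((hint ψ).mono_set hsub)]
        simp only [hI]; ring
      rw [this, ← Real.norm_eq_abs]
      refine intervalIntegral.norm_integral_le_of_norm_le hx.1 (Filter.Eventually.of_forall
        fun t ht => ?_) ((hEp.1.mono_set hsub).mul_const _)
      rw [Real.norm_eq_abs, add_sub_add_left_eq_sub, ← mul_sub, abs_mul]
      have h1 := abs_sin_sq_sub_sin_sq_le (exp (2 * W t) * IccExtend hb φ t)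
        (exp (2 * W t) * IccExtend hb ψ t)
      have h2 : |IccExtend hb φ t - IccExtend hb ψ t| ≤ dist φ ψ := by
        rw [← Real.dist_eq]
        exact ContinuousMap.dist_apply_le_dist _
      rw [← mul_sub, abs_mul, abs_of_pos (exp_pos _)] at h1
      calc _ ≤ |p t| * (exp (2 * W t) * dist φ ψ) := by gcongr; exact h1.trans (by gcongr)
        _ = _ := by ring
    have hE : ∫ t in (0:ℝ)..x, (2 * exp (2 * W t) * |p t|) * (dist φ ψ / 2)
        = (exp (2 * W x) - 1) * (dist φ ψ / 2) := by
      rw [intervalIntegral.integral_mul_const]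
      have := hEp.2 x hx
      have hW0 : W 0 = 0 := by simp [hW]
      simp only [hW0, mul_zero, exp_zero] at this
      rw [this]; ring
    change dist (exp (-(2 * W x)) * I φ x) (exp (-(2 * W x)) * I ψ x) ≤ _
    rw [Real.dist_eq, ← mul_sub, abs_mul, abs_of_pos (exp_pos _)]
    calc exp (-(2 * W x)) * |I φ x - I ψ x|
        ≤ exp (-(2 * W x)) * (exp (2 * W x) * (dist φ ψ / 2)) := by
          gcongr
          rw [hE] at hd
          nlinarith [dist_nonneg (x := φ) (y := ψ)]
      _ = dist φ ψ / 2 := by rw [← mul_assoc, ← exp_add]; simp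
      _ = _ := by simp; ring
  obtain ⟨φ, hφ⟩ : ∃ φ, S φ = φ := ⟨_, hS.fixedPoint_isFixedPt⟩
  refine ⟨I φ, by simp [hI], (hIp φ).congr hb (fun x hx => ?_) fun x _ => rfl⟩
  have : IccExtend hb φ x = exp (-(2 * W x)) * I φ x := by
    rw [IccExtend_of_mem hb _ hx]
    exact (DFunLike.congr_fun hφ ⟨x, hx⟩).symm
  simp only [this]
  rw [← mul_assoc, ← exp_add]
  simp

theorem mul_sinc_eq_sin (x : ℝ) : x * sinc x = sin x := by
  by_cases hx : x = 0
  · simp [hx]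
  · rw [sinc_of_ne_zero hx]; field_simp

theorem sin_sub_int_mul_pi_sq (x : ℝ) (m : ℤ) : sin (x - m * π) ^ 2 = sin x ^ 2 := by
  rw [sin_sub_int_mul_pi, mul_pow]
  have : ((-1 : ℝ) ^ m) ^ 2 = 1 := by
    rw [← zpow_natCast, ← zpow_mul, mul_comm, zpow_mul]; simp
  rw [this, one_mul]

namespace IsPruferAngle

variable {b : ℝ} {p θ : ℝ → ℝ}

theorem continuousOn (hb : 0 ≤ b) (hθ : IsPruferAngle b p θ) : ContinuousOn θ (Icc 0 b) :=
  IsPrimitive.continuousOn hb hθ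

/-- A solution of the Prüfer equation crosses every multiple of `π` upwards. -/
theorem int_mul_pi_lt (hb : 0 ≤ b) (hp : IntervalIntegrable p volume 0 b)
    (hθ : IsPruferAngle b p θ) {m : ℤ} {a x : ℝ} (ha : a ∈ Icc 0 b) (hx : x ∈ Icc 0 b)
    (hax : a < x) (hm : m * π ≤ θ a) : m * π < θ x := by
  set φ : ℝ → ℝ := fun t => θ t - m * π with hφ
  have hφc : ContinuousOn φ (uIcc 0 b) := by
    rw [uIcc_of_le hb]; exact (hθ.continuousOn hb).sub continuousOn_const
  have hc : IntervalIntegrable (fun t => p t * (sinc (φ t) * sin (φ t))) volume 0 b :=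
    hp.mul_continuousOn ((continuous_sinc.comp_continuousOn hφc).mul
      (continuous_sin.comp_continuousOn hφc))
  have hφp : IsPrimitive b (fun t => p t * (sinc (φ t) * sin (φ t)) * φ t + 1) φ := by
    refine ⟨(hc.mul_continuousOn hφc).add intervalIntegrable_const, fun z hz => ?_⟩
    have h := hθ.2 z hz
    have h' : ∀ t, p t * (sinc (φ t) * sin (φ t)) * φ t + 1 = 1 + p t * sin (θ t) ^ 2 := by
      intro t
      rw [← sin_sub_int_mul_pi_sq (θ t) m]
      change _ = 1 + p t * sin (φ t) ^ 2
      linear_combination (p t * sin (φ t)) * mul_sinc_eq_sin (φ t)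
    simp only [h']
    simp only [hφ, h]; ring
  have hv := hφp.mul_exp_neg_integral hb hc
  have hd := hv.sub_eq_integral ha hx
  have hsub : Icc a x ⊆ Icc 0 b := Icc_subset_Icc ha.1 hx.2
  have hC : ContinuousOn (fun t => 1 * exp (-∫ s in (0:ℝ)..t, p s * (sinc (φ s) * sin (φ s))))
      (Icc a x) := by
    have := (IsPrimitive.of_integral hc 0).continuousOn hb
    simp only [zero_add] at this
    exact continuousOn_const.mul (this.mono hsub).neg.rexp
  have hpos := intervalIntegral.intervalIntegral_pos_of_pos_on
    (hC.intervalIntegrable_of_Icc hax.le) (fun t _ => by positivity) hax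
  rw [← hd] at hpos
  have h0 : 0 ≤ φ a := by simp only [hφ]; linarith
  have h1 : 0 < φ x * exp (-∫ s in (0:ℝ)..x, p s * (sinc (φ s) * sin (φ s))) := by
    have := mul_nonneg h0
      (exp_pos (-∫ s in (0:ℝ)..a, p s * (sinc (φ s) * sin (φ s)))).le
    linarith
  have := pos_of_mul_pos_left h1 (exp_pos _).le
  simp only [hφ] at this
  linarith

theorem exists_sin_ne_zero (hθ : IsPruferAngle b p θ) (hb : 0 < b) :
    ∃ x ∈ Icc 0 b, sin (θ x) ≠ 0 := by
  by_contra! h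
  have hm : min b 1 ∈ Icc 0 b := ⟨by positivity, min_le_left _ _⟩
  have h1 := hθ.2 _ hm
  have h2 : ∫ t in (0:ℝ)..(min b 1), (1 + p t * sin (θ t) ^ 2) = ∫ t in (0:ℝ)..(min b 1), 1 := by
    apply intervalIntegral.integral_congr
    intro t ht
    rw [uIcc_of_le hm.1] at ht
    simp [h t ⟨ht.1, ht.2.trans hm.2⟩]
  rw [h2, intervalIntegral.integral_const] at h1
  have h3 := h _ hm
  have h4 := h 0 ⟨le_rfl, hb.le⟩
  rw [h1, sin_add, h4] at h3
  have h5 : 0 < sin (min b 1) :=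
    sin_pos_of_pos_of_lt_pi (by positivity) ((min_le_right _ _).trans_lt (by linarith [pi_gt_three]))
  have h6 := sin_sq_add_cos_sq (θ 0)
  simp only [zero_mul, zero_add, sub_zero, smul_eq_mul, mul_one, mul_eq_zero] at h3
  rcases h3 with h3 | h3
  · rw [h3, h4] at h6; norm_num at h6
  · exact absurd h3 (ne_of_gt h5)

/-- The difference of two Prüfer angles whose potentials differ by a constant `δ` solves a linear
equation with the nonnegative (for `δ ≥ 0`) forcing term `δ sin² θ₂`. -/
theorem exists_linear_sub (hb : 0 ≤ b) (hp : IntervalIntegrable p volume 0 b) {θ₂ : ℝ → ℝ} {δ : ℝ}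
    (hθ : IsPruferAngle b p θ) (hθ₂ : IsPruferAngle b (fun t => p t + δ) θ₂) (h0 : θ 0 = θ₂ 0) :
    ∃ c : ℝ → ℝ, IntervalIntegrable c volume 0 b ∧ (∀ t, |c t| ≤ |p t|) ∧ ∀ x ∈ Icc 0 b,
      (θ₂ x - θ x) * exp (-∫ t in (0:ℝ)..x, c t)
        = ∫ t in (0:ℝ)..x, δ * sin (θ₂ t) ^ 2 * exp (-∫ s in (0:ℝ)..t, c s) := by
  have hc1 : ContinuousOn θ (uIcc 0 b) := by
    rw [uIcc_of_le hb]; exact hθ.continuousOn hb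
  have hc2 : ContinuousOn θ₂ (uIcc 0 b) := by
    rw [uIcc_of_le hb]; exact hθ₂.continuousOn hb
  have hc : IntervalIntegrable (fun t => p t * (sinc (θ₂ t - θ t) * sin (θ₂ t + θ t))) volume 0 b :=
    hp.mul_continuousOn ((continuous_sinc.comp_continuousOn (hc2.sub hc1)).mul
      (continuous_sin.comp_continuousOn (hc2.add hc1)))
  refine ⟨_, hc, fun t => ?_, fun x hx => ?_⟩
  · rw [abs_mul, abs_mul]
    have := mul_le_mul (abs_sinc_le_one (θ₂ t - θ t)) (abs_sin_le_one (θ₂ t + θ t))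
      (abs_nonneg _) zero_le_one
    nlinarith [abs_nonneg (p t)]
  · have hD : IsPrimitive b (fun t => p t * (sinc (θ₂ t - θ t) * sin (θ₂ t + θ t)) * (θ₂ t - θ t)
        + δ * sin (θ₂ t) ^ 2) (fun t => θ₂ t - θ t) := by
      refine (IsPrimitive.sub hb hθ₂ hθ).congr hb (fun t _ => ?_) fun t _ => rfl
      have h : sin (θ₂ t) ^ 2 - sin (θ t) ^ 2 = sin (θ₂ t - θ t) * sin (θ₂ t + θ t) := by
        rw [sin_sub, sin_add]
        linear_combination sin (θ t) ^ 2 * sin_sq_add_cos_sq (θ₂ t)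
          - sin (θ₂ t) ^ 2 * sin_sq_add_cos_sq (θ t)
      rw [← mul_sinc_eq_sin (θ₂ t - θ t)] at h
      linear_combination p t * h
    have := (hD.mul_exp_neg_integral hb hc).2 x hx
    simpa [h0] using this

theorem le_of_le (hb : 0 ≤ b) (hp : IntervalIntegrable p volume 0 b) {θ₂ : ℝ → ℝ} {δ : ℝ}
    (hθ : IsPruferAngle b p θ) (hθ₂ : IsPruferAngle b (fun t => p t + δ) θ₂) (h0 : θ 0 = θ₂ 0)
    (hδ : 0 ≤ δ) {x : ℝ} (hx : x ∈ Icc 0 b) : θ x ≤ θ₂ x := by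
  obtain ⟨c, -, -, h⟩ := exists_linear_sub hb hp hθ hθ₂ h0
  have h1 : 0 ≤ (θ₂ x - θ x) * exp (-∫ t in (0:ℝ)..x, c t) := by
    rw [h x hx]
    exact intervalIntegral.integral_nonneg hx.1 fun t _ => by positivity
  have := nonneg_of_mul_nonneg_left h1 (exp_pos _)
  linarith

theorem lt_of_lt (hb : 0 < b) (hp : IntervalIntegrable p volume 0 b) {θ₂ : ℝ → ℝ} {δ : ℝ}
    (hθ : IsPruferAngle b p θ) (hθ₂ : IsPruferAngle b (fun t => p t + δ) θ₂) (h0 : θ 0 = θ₂ 0)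
    (hδ : 0 < δ) : θ b < θ₂ b := by
  obtain ⟨c, hc, -, h⟩ := exists_linear_sub hb.le hp hθ hθ₂ h0
  have hb' : b ∈ Icc 0 b := ⟨hb.le, le_rfl⟩
  have hC : ContinuousOn (fun t => ∫ s in (0:ℝ)..t, c s) (Icc 0 b) := by
    simpa using (IsPrimitive.of_integral hc 0).continuousOn hb.le
  have h1 : 0 < (θ₂ b - θ b) * exp (-∫ t in (0:ℝ)..b, c t) := by
    rw [h b hb']
    obtain ⟨x, hx, hne⟩ := hθ₂.exists_sin_ne_zero hb
    refine intervalIntegral.integral_pos hb ?_ (fun t _ => by positivity) ⟨x, hx, by positivity⟩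
    exact (continuousOn_const.mul
      ((continuous_sin.comp_continuousOn (hθ₂.continuousOn hb.le)).pow 2)).mul hC.neg.rexp
  have := pos_of_mul_pos_left h1 (exp_pos _).le
  linarith

theorem abs_sub_le (hb : 0 ≤ b) (hp : IntervalIntegrable p volume 0 b) {θ₂ : ℝ → ℝ} {δ : ℝ}
    (hθ : IsPruferAngle b p θ) (hθ₂ : IsPruferAngle b (fun t => p t + δ) θ₂) (h0 : θ 0 = θ₂ 0) :
    |θ₂ b - θ b| ≤ exp (∫ t in (0:ℝ)..b, |p t|) * (exp (∫ t in (0:ℝ)..b, |p t|) * b) * |δ| := by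
  obtain ⟨c, hc, hcp, h⟩ := exists_linear_sub hb hp hθ hθ₂ h0
  have hb' : b ∈ Icc 0 b := ⟨hb, le_rfl⟩
  set P := ∫ t in (0:ℝ)..b, |p t| with hP
  have hI : ∀ x ∈ Icc 0 b, |∫ t in (0:ℝ)..x, c t| ≤ P := by
    intro x hx
    have hsub : uIcc 0 x ⊆ uIcc 0 b := by
      rw [uIcc_of_le hx.1, uIcc_of_le hb]; exact Icc_subset_Icc_right hx.2
    have h1 : |∫ t in (0:ℝ)..x, c t| ≤ ∫ t in (0:ℝ)..x, |p t| := by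
      rw [← Real.norm_eq_abs]
      exact intervalIntegral.norm_integral_le_of_norm_le hx.1 (Filter.Eventually.of_forall
        fun t _ => hcp t) (hp.abs.mono_set hsub)
    exact h1.trans (intervalIntegral.integral_mono_interval le_rfl hx.1 hx.2
      (Filter.Eventually.of_forall fun t => abs_nonneg _) hp.abs)
  have hR : |∫ t in (0:ℝ)..b, δ * sin (θ₂ t) ^ 2 * exp (-∫ s in (0:ℝ)..t, c s)|
      ≤ |δ| * exp P * |b - 0| := by
    rw [← Real.norm_eq_abs]
    refine intervalIntegral.norm_integral_le_of_norm_le_const fun t ht => ?_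
    rw [uIoc_of_le hb] at ht
    rw [Real.norm_eq_abs, abs_mul, abs_mul, abs_of_pos (exp_pos _),
      abs_of_nonneg (sq_nonneg (sin (θ₂ t)))]
    gcongr
    · exact mul_le_of_le_one_right (abs_nonneg _) (sin_sq_le_one _)
    · exact (neg_le_abs _).trans (hI t (Ioc_subset_Icc_self ht))
  have hs : θ₂ b - θ b = exp (∫ t in (0:ℝ)..b, c t) *
      ∫ t in (0:ℝ)..b, δ * sin (θ₂ t) ^ 2 * exp (-∫ s in (0:ℝ)..t, c s) := by
    rw [← h b hb', mul_left_comm, ← exp_add]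
    simp
  rw [hs, abs_mul, abs_of_pos (exp_pos _)]
  rw [sub_zero, abs_of_nonneg hb] at hR
  calc _ ≤ exp P * (|δ| * exp P * b) := by
        gcongr
        exact (le_abs_self _).trans (hI b hb')
    _ = _ := by ring

end IsPruferAngle

open Filter Topology in
/-- As the spectral parameter tends to `-∞`, the Prüfer angle at the right endpoint becomes
arbitrarily small. -/
theorem exists_isPruferAngle_lt {p : ℝ → ℝ} (hp : IntervalIntegrable p volume 0 π) {θ₀ : ℝ}
    (h0 : 0 ≤ θ₀) (hπ : θ₀ < π) {θ : ℕ → ℝ → ℝ} (hθ0 : ∀ k, θ k 0 = θ₀)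
    (hθ : ∀ k : ℕ, IsPruferAngle π (fun t => p t - k) (θ k)) {ε : ℝ} (hε : 0 < ε) :
    ∃ k, θ k π < ε := by
  have hb : (0:ℝ) ≤ π := pi_pos.le
  have hpk : ∀ k : ℕ, IntervalIntegrable (fun t => p t - k) volume 0 π := fun k =>
    hp.sub intervalIntegrable_const
  have h0mem : (0:ℝ) ∈ Icc 0 π := ⟨le_rfl, hb⟩
  have hπmem : π ∈ Icc 0 π := ⟨hb, le_rfl⟩
  have hcont : ∀ k, ContinuousOn (fun t => sin (θ k t) ^ 2) (Icc 0 π) := fun k =>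
    (continuous_sin.comp_continuousOn ((hθ k).continuousOn hb)).pow 2
  have hcontu : ∀ k, ContinuousOn (fun t => sin (θ k t) ^ 2) (uIcc 0 π) := fun k => by
    rw [uIcc_of_le hb]; exact hcont k
  have hnn : ∀ k, ∀ x ∈ Icc 0 π, 0 ≤ θ k x := by
    intro k x hx
    rcases hx.1.eq_or_lt with h | h
    · rw [← h, hθ0]; exact h0
    · have := (hθ k).int_mul_pi_lt hb (hpk k) (m := 0) h0mem hx h (by rw [hθ0]; simpa using h0)
      simpa using this.le
  have hanti : ∀ x ∈ Icc 0 π, Antitone fun k => θ k x := by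
    intro x hx
    refine antitone_nat_of_succ_le fun k => ?_
    refine (hθ (k + 1)).le_of_le hb (hpk _) (δ := 1) ?_ (by rw [hθ0, hθ0]) zero_le_one hx
    have h := hθ k
    convert h using 2
    push_cast; ring
  set Θ : ℝ → ℝ := fun x => ⨅ k, θ k x with hΘ
  have hlim : ∀ x ∈ Icc 0 π, Tendsto (fun k => θ k x) atTop (𝓝 (Θ x)) := fun x hx =>
    tendsto_atTop_ciInf (hanti x hx) ⟨0, by rintro _ ⟨k, rfl⟩; exact hnn k x hx⟩
  have hsplit : ∀ k : ℕ, ∀ x ∈ Icc 0 π, ∀ z ∈ Icc 0 π, x ≤ z → θ k z - θ k x + k *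
      ∫ t in x..z, sin (θ k t) ^ 2 ≤ (z - x) + ∫ t in (0:ℝ)..π, |p t| * sin (θ k t) ^ 2 := by
    intro k x hx z hz hxz
    have hsub : uIcc x z ⊆ uIcc 0 π := uIcc_subset_uIcc (Icc_subset_uIcc hx) (Icc_subset_uIcc hz)
    have hs : IntervalIntegrable (fun t => sin (θ k t) ^ 2) volume x z :=
      ((hcontu k).mono hsub).intervalIntegrable
    have hps := (hp.mono_set hsub).mul_continuousOn ((hcontu k).mono hsub)
    have hpas := hp.abs.mul_continuousOn (hcontu k)
    have h1 : ∫ t in x..z, (1 + (p t - k) * sin (θ k t) ^ 2)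
        = (z - x) + (∫ t in x..z, p t * sin (θ k t) ^ 2) - k * ∫ t in x..z, sin (θ k t) ^ 2 := by
      have : ∀ t, 1 + (p t - k) * sin (θ k t) ^ 2
          = 1 + p t * sin (θ k t) ^ 2 - k * sin (θ k t) ^ 2 := fun t => by ring
      simp only [this]
      rw [intervalIntegral.integral_sub (intervalIntegrable_const.add hps) (hs.const_mul _),
        intervalIntegral.integral_add intervalIntegrable_const hps,
        intervalIntegral.integral_const_mul]
      simp
    have h2 : ∫ t in x..z, p t * sin (θ k t) ^ 2 ≤ ∫ t in x..z, |p t| * sin (θ k t) ^ 2 :=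
      intervalIntegral.integral_mono_on hxz hps (hpas.mono_set hsub) fun t _ =>
        mul_le_mul_of_nonneg_right (le_abs_self _) (sq_nonneg _)
    have h3 : ∫ t in x..z, |p t| * sin (θ k t) ^ 2 ≤ ∫ t in (0:ℝ)..π, |p t| * sin (θ k t) ^ 2 :=
      intervalIntegral.integral_mono_interval hx.1 hxz hz.2
        (Eventually.of_forall fun t => by positivity) hpas
    have h4 := IsPrimitive.sub_eq_integral (hθ k) hx hz
    rw [h1] at h4
    linarith
  have hae : ∀ᵐ t, t ∈ uIoc 0 π → Tendsto (fun k => sin (θ k t) ^ 2) atTop (𝓝 (sin (Θ t) ^ 2)) :=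
    Eventually.of_forall fun t ht => by
      rw [uIoc_of_le hb] at ht
      exact (continuous_sin.tendsto _ |>.comp (hlim t (Ioc_subset_Icc_self ht))).pow 2
  have hdct : Tendsto (fun k => ∫ t in (0:ℝ)..π, sin (θ k t) ^ 2) atTop
      (𝓝 (∫ t in (0:ℝ)..π, sin (Θ t) ^ 2)) := by
    refine intervalIntegral.tendsto_integral_filter_of_dominated_convergence (fun _ => 1)
      (Eventually.of_forall fun k => (hcontu k).intervalIntegrable.aestronglyMeasurable_restrict_uIoc)
      (Eventually.of_forall fun k => Eventually.of_forall fun t _ => ?_)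
      intervalIntegrable_const hae
    rw [Real.norm_eq_abs, abs_of_nonneg (sq_nonneg _)]
    exact sin_sq_le_one _
  set K := π + ∫ t in (0:ℝ)..π, |p t| with hK
  have hbound : ∀ k : ℕ, ∫ t in (0:ℝ)..π, sin (θ (k + 1) t) ^ 2 ≤ (K + π) / ((k : ℝ) + 1) := by
    intro k
    rw [le_div_iff₀ (by positivity)]
    have h1 := hsplit (k + 1) 0 h0mem π hπmem hb
    have h2 : ∫ t in (0:ℝ)..π, |p t| * sin (θ (k + 1) t) ^ 2 ≤ ∫ t in (0:ℝ)..π, |p t| :=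
      intervalIntegral.integral_mono_on hb (hp.abs.mul_continuousOn (hcontu _)) hp.abs fun t _ =>
        mul_le_of_le_one_right (abs_nonneg _) (sin_sq_le_one _)
    have h3 := hnn (k + 1) π hπmem
    rw [hθ0] at h1
    push_cast at h1
    linarith
  have hzero : ∫ t in (0:ℝ)..π, sin (Θ t) ^ 2 = 0 := by
    refine le_antisymm ?_ (intervalIntegral.integral_nonneg hb fun t _ => sq_nonneg _)
    refine le_of_tendsto_of_tendsto' (hdct.comp (tendsto_add_atTop_nat 1)) ?_ hbound
    have := (tendsto_one_div_add_atTop_nhds_zero_nat (𝕜 := ℝ)).const_mul (K + π)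
    simpa [div_eq_mul_inv] using this
  have hmeas : AEStronglyMeasurable (fun t => sin (Θ t) ^ 2) (volume.restrict (uIoc 0 π)) :=
    aestronglyMeasurable_of_tendsto_ae atTop
      (fun k => (hcontu k).intervalIntegrable.aestronglyMeasurable_restrict_uIoc)
      ((ae_restrict_iff' measurableSet_uIoc).2 hae)
  have hint : IntervalIntegrable (fun t => sin (Θ t) ^ 2) volume 0 π := by
    refine (intervalIntegrable_const (c := (1:ℝ))).mono_fun hmeas (Eventually.of_forall fun t => ?_)
    simp only [Real.norm_eq_abs, abs_one]
    rw [abs_of_nonneg (sq_nonneg _)]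
    exact sin_sq_le_one _
  have hsin : ∀ᵐ t, t ∈ Ioc 0 π → sin (Θ t) = 0 := by
    have := (intervalIntegral.integral_eq_zero_iff_of_le_of_nonneg_ae hb
      (Eventually.of_forall fun t => sq_nonneg _) hint).1 hzero
    rw [Filter.EventuallyEq, ae_restrict_iff' measurableSet_Ioc] at this
    filter_upwards [this] with t h ht
    simpa using h ht
  have hdct' : Tendsto (fun k => ∫ t in (0:ℝ)..π, |p t| * sin (θ k t) ^ 2) atTop (𝓝 0) := by
    have h : Tendsto (fun k => ∫ t in (0:ℝ)..π, |p t| * sin (θ k t) ^ 2) atTop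
        (𝓝 (∫ t in (0:ℝ)..π, (0:ℝ))) := by
      refine intervalIntegral.tendsto_integral_filter_of_dominated_convergence (fun t => |p t|)
        (Eventually.of_forall fun k =>
          (hp.abs.mul_continuousOn (hcontu k)).aestronglyMeasurable_restrict_uIoc)
        (Eventually.of_forall fun k => Eventually.of_forall fun t _ => ?_) hp.abs ?_
      · rw [Real.norm_eq_abs, abs_of_nonneg (by positivity)]
        exact mul_le_of_le_one_right (abs_nonneg _) (sin_sq_le_one _)
      · filter_upwards [hae, hsin] with t h1 h2 ht
        have h3 := (h1 ht).const_mul (|p t|)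
        rw [uIoc_of_le hb] at ht
        simpa [h2 ht] using h3
    simpa using h
  have hinc : ∀ x ∈ Icc 0 π, ∀ z ∈ Icc 0 π, x ≤ z → Θ z - Θ x ≤ z - x := by
    intro x hx z hz hxz
    refine le_of_tendsto_of_tendsto' ((hlim z hz).sub (hlim x hx))
      (by simpa using hdct'.const_add (z - x)) fun k => ?_
    have h1 := hsplit k x hx z hz hxz
    have h2 : 0 ≤ (k : ℝ) * ∫ t in x..z, sin (θ k t) ^ 2 :=
      mul_nonneg (Nat.cast_nonneg _) (intervalIntegral.integral_nonneg hxz fun t _ => sq_nonneg _)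
    linarith
  have hdense : ∀ a c : ℝ, 0 ≤ a → a < c → c ≤ π → ∃ t ∈ Ioo a c, sin (Θ t) = 0 := by
    intro a c ha hac hc
    by_contra! h
    have : ∀ᵐ t, t ∉ Ioo a c := by
      filter_upwards [hsin] with t ht htm
      exact h t htm (ht ⟨ha.trans_lt htm.1, htm.2.le.trans hc⟩)
    rw [← measure_eq_zero_iff_ae_notMem, Real.volume_Ioo, ENNReal.ofReal_eq_zero] at this
    linarith
  have hΘ0 : Θ 0 = θ₀ := by simp [hΘ, hθ0]
  have hΘnn : ∀ x ∈ Icc 0 π, 0 ≤ Θ x := fun x hx => ge_of_tendsto' (hlim x hx) fun k => hnn k x hx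
  have hvanish : ∀ x ∈ Icc 0 π, sin (Θ x) = 0 → Θ x < π → Θ x = 0 := fun x hx h1 h2 =>
    (sin_eq_zero_iff_of_lt_of_lt (by linarith [hΘnn x hx, pi_pos]) h2).1 h1
  obtain ⟨t₀, ht₀, hs₀⟩ := hdense 0 (π - θ₀) le_rfl (by linarith) (by linarith)
  have hm₀ : t₀ ∈ Icc 0 π := ⟨ht₀.1.le, by linarith [ht₀.2]⟩
  have hz₀ : Θ t₀ = 0 := hvanish t₀ hm₀ hs₀ (by
    have := hinc 0 h0mem t₀ hm₀ ht₀.1.le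
    linarith [ht₀.2])
  obtain ⟨t₁, ht₁, hs₁⟩ := hdense (max t₀ (π - ε)) π (hm₀.1.trans (le_max_left _ _))
    (max_lt (by linarith [ht₀.2]) (by linarith)) le_rfl
  have ht₁' := max_lt_iff.1 ht₁.1
  have hm₁ : t₁ ∈ Icc 0 π := ⟨hm₀.1.trans ht₁'.1.le, ht₁.2.le⟩
  have hz₁ : Θ t₁ = 0 := hvanish t₁ hm₁ hs₁ (by
    have := hinc t₀ hm₀ t₁ hm₁ ht₁'.1.le
    linarith [ht₀.1, ht₁.2])
  have hfin : Θ π < ε := by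
    have := hinc t₁ hm₁ π hπmem ht₁.2.le
    linarith
  exact ((hlim π hπmem).eventually (gt_mem_nhds hfin)).exists

namespace IsPruferAngle

variable {b : ℝ} {p θ : ℝ → ℝ}

theorem hasPrimitive_sin (hb : 0 ≤ b) (hθ : IsPruferAngle b p θ) :
    IsPrimitive b (fun x => cos (θ x) * (1 + p x * sin (θ x) ^ 2)) (fun x => sin (θ x)) :=
  IsPrimitive.comp hb hθ hasDerivAt_sin continuous_cos

theorem hasPrimitive_cos (hb : 0 ≤ b) (hθ : IsPruferAngle b p θ) :
    IsPrimitive b (fun x => -sin (θ x) * (1 + p x * sin (θ x) ^ 2)) (fun x => cos (θ x)) :=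
  IsPrimitive.comp hb hθ hasDerivAt_cos continuous_sin.neg

theorem intervalIntegrable_mul_sin_mul_cos (hb : 0 ≤ b) (hp : IntervalIntegrable p volume 0 b)
    (hθ : IsPruferAngle b p θ) :
    IntervalIntegrable (fun x => p x * (sin (θ x) * cos (θ x))) volume 0 b := by
  refine hp.mul_continuousOn ?_
  rw [uIcc_of_le hb]
  exact (continuous_sin.comp_continuousOn (hθ.continuousOn hb)).mul
    (continuous_cos.comp_continuousOn (hθ.continuousOn hb))

/-- Polar form of a solution of `y'' = -(1 + p) y` whose initial direction is that of the Prüfer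
angle. -/
theorem exists_polar (hb : 0 ≤ b) (hp : IntervalIntegrable p volume 0 b)
    (hθ : IsPruferAngle b p θ) {y y' : ℝ → ℝ} (hy : IsPrimitive b y' y)
    (hy' : IsPrimitive b (fun x => -(1 + p x) * y x) y')
    (h0 : y 0 * cos (θ 0) - y' 0 * sin (θ 0) = 0) :
    ∃ (r : ℝ) (E : ℝ → ℝ), (∀ x, 0 < E x) ∧
      ∀ x ∈ Icc 0 b, y x = r * E x * sin (θ x) ∧ y' x = r * E x * cos (θ x) := by
  have hs := hθ.hasPrimitive_sin hb
  have hc := hθ.hasPrimitive_cos hb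
  have hi := hθ.intervalIntegrable_mul_sin_mul_cos hb hp
  have hP : IsPrimitive b
      (fun x => p x * (sin (θ x) * cos (θ x)) * (y x * cos (θ x) - y' x * sin (θ x)))
      (fun x => y x * cos (θ x) - y' x * sin (θ x)) := by
    refine ((hy.mul hb hc).sub hb (hy'.mul hb hs)).congr hb (fun x _ => ?_) fun x _ => rfl
    linear_combination (p x * y x * sin (θ x)) * sin_sq_add_cos_sq (θ x) * (-1)
  have hP0 : ∀ x ∈ Icc 0 b, y x * cos (θ x) - y' x * sin (θ x) = 0 := by
    intro x hx
    have := hP.eq_mul_exp_integral hb hi hx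
    simpa [h0] using this
  have hQ : IsPrimitive b
      (fun x => -(p x * (sin (θ x) * cos (θ x))) * (y x * sin (θ x) + y' x * cos (θ x)))
      (fun x => y x * sin (θ x) + y' x * cos (θ x)) := by
    refine ((hy.mul hb hs).add hb (hy'.mul hb hc)).congr hb (fun x hx => ?_) fun x _ => rfl
    have h1 := hP0 x hx
    have h2 := sin_sq_add_cos_sq (θ x)
    linear_combination (p x * (sin (θ x) ^ 2 - cos (θ x) ^ 2)) * h1
      + (p x * y x * cos (θ x)) * h2
  refine ⟨y 0 * sin (θ 0) + y' 0 * cos (θ 0),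
    fun x => exp (∫ t in (0:ℝ)..x, -(p t * (sin (θ t) * cos (θ t)))), fun x => exp_pos _,
    fun x hx => ?_⟩
  have h1 := hP0 x hx
  have h2 := sin_sq_add_cos_sq (θ x)
  have h3 := hQ.eq_mul_exp_integral hb hi.neg hx
  simp only [Pi.neg_apply] at h3
  beta_reduce
  rw [← h3]
  constructor
  · linear_combination cos (θ x) * h1 - y x * h2
  · linear_combination -sin (θ x) * h1 - y' x * h2

/-- Every Prüfer angle is the polar angle of a nowhere degenerate solution of `y'' = -(1 + p) y`. -/
theorem exists_solution (hb : 0 ≤ b) (hp : IntervalIntegrable p volume 0 b)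
    (hθ : IsPruferAngle b p θ) :
    ∃ E : ℝ → ℝ, (∀ x, 0 < E x) ∧
      IsPrimitive b (fun x => E x * cos (θ x)) (fun x => E x * sin (θ x)) ∧
      IsPrimitive b (fun x => -(1 + p x) * (E x * sin (θ x))) (fun x => E x * cos (θ x)) := by
  have hs := hθ.hasPrimitive_sin hb
  have hc := hθ.hasPrimitive_cos hb
  have hi := hθ.intervalIntegrable_mul_sin_mul_cos hb hp
  have hE := (IsPrimitive.of_integral hi.neg 0).comp hb hasDerivAt_exp continuous_exp
  refine ⟨_, fun x => exp_pos _, (hE.mul hb hs).congr hb (fun x _ => ?_) fun x _ => rfl,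
    (hE.mul hb hc).congr hb (fun x _ => ?_) fun x _ => rfl⟩
  · simp only [Pi.neg_apply]
    ring
  · simp only [Pi.neg_apply]
    generalize exp _ = e
    linear_combination (-(p x * e * sin (θ x))) * sin_sq_add_cos_sq (θ x)

/-- The number of zeros of `sin θ` is the number of multiples of `π` between `θ 0` and `θ b`. -/
theorem ncard_sin_eq_zero (hb : 0 ≤ b) (hp : IntervalIntegrable p volume 0 b)
    (hθ : IsPruferAngle b p θ) {lo hi : ℤ}
    (h : ∀ m : ℤ, (θ 0 ≤ m * π ∧ m * π ≤ θ b) ↔ (lo ≤ m ∧ m ≤ hi)) :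
    {x ∈ Icc 0 b | sin (θ x) = 0}.ncard = (hi + 1 - lo).toNat := by
  have hex : ∀ m ∈ Icc lo hi, ∃ x ∈ Icc 0 b, θ x = m * π := fun m hm =>
    intermediate_value_Icc hb (hθ.continuousOn hb) ((h m).2 hm)
  have h0 : (0:ℝ) ∈ Icc 0 b := ⟨le_rfl, hb⟩
  have hbm : b ∈ Icc 0 b := ⟨hb, le_rfl⟩
  choose! g hg hgθ using hex
  have himg : {x ∈ Icc 0 b | sin (θ x) = 0} = g '' Icc lo hi := by
    ext x
    constructor
    · rintro ⟨hx, hs⟩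
      obtain ⟨m, hm⟩ := sin_eq_zero_iff.1 hs
      have hmem : m ∈ Icc lo hi := by
        refine (h m).1 ⟨?_, ?_⟩
        · by_contra! hlt
          rcases hx.1.eq_or_lt with h' | h'
          · rw [hm, h'] at hlt; exact lt_irrefl _ hlt
          · exact (hθ.int_mul_pi_lt hb hp h0 hx h' hlt.le).ne hm
        · rcases hx.2.eq_or_lt with h' | h'
          · rw [hm, h']
          · exact (hθ.int_mul_pi_lt hb hp hx hbm h' hm.le).le
      refine ⟨m, hmem, ?_⟩
      have hgm := hgθ m hmem
      rcases lt_trichotomy (g m) x with h' | h' | h'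
      · exact absurd hm (hθ.int_mul_pi_lt hb hp (hg m hmem) hx h' hgm.ge).ne
      · exact h'
      · exact absurd hgm.symm (hθ.int_mul_pi_lt hb hp hx (hg m hmem) h' hm.le).ne
    · rintro ⟨m, hm, rfl⟩
      exact ⟨hg m hm, by rw [hgθ m hm]; exact sin_int_mul_pi m⟩
  have hinj : InjOn g (Icc lo hi) := by
    intro m hm n hn hmn
    have h1 := hgθ m hm
    rw [hmn, hgθ n hn] at h1
    exact_mod_cast (mul_right_cancel₀ pi_ne_zero h1).symm
  rw [himg, hinj.ncard_image, ncard_eq_toFinset_card', toFinset_Icc, Int.card_Icc]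

end IsPruferAngle

theorem SLSol.isPrimitive {q y y' : ℝ → ℝ} {μ : ℝ} (hq : IntervalIntegrable q volume 0 π)
    (h : SLSol q μ y y') : IsPrimitive π y' y ∧
      IsPrimitive π (fun x => -(1 + (μ - q x - 1)) * y x) y' := by
  obtain ⟨hy, hy', h1, h2⟩ := h
  rw [← uIcc_of_le pi_pos.le] at hy hy'
  refine ⟨⟨hy'.intervalIntegrable, h1⟩, ?_⟩
  have h3 : ∀ x, -(1 + (μ - q x - 1)) * y x = (q x - μ) * y x := fun x => by ring
  simp only [h3]
  exact ⟨(hq.sub intervalIntegrable_const).mul_continuousOn hy, h2⟩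

theorem IsEigenpair.sin_pruferAngle {q y y' θ : ℝ → ℝ} {α β μ : ℝ}
    (hq : IntervalIntegrable q volume 0 π) (h : IsEigenpair q α β μ y y')
    (hθ0 : θ 0 = π - α) (hθ : IsPruferAngle π (fun t => μ - q t - 1) θ) :
    sin (θ π + β) = 0 ∧ ∀ x ∈ Icc 0 π, y x = 0 ↔ sin (θ x) = 0 := by
  obtain ⟨hsol, ⟨z, hz, hyz⟩, hα, hβ⟩ := h
  obtain ⟨hy, hy'⟩ := hsol.isPrimitive hq
  obtain ⟨r, E, hE, hr⟩ := hθ.exists_polar pi_pos.le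
    ((intervalIntegrable_const.sub hq).sub intervalIntegrable_const) hy hy'
    (by rw [hθ0, cos_pi_sub, sin_pi_sub]; linarith)
  have hr0 : r ≠ 0 := by
    rintro rfl
    exact hyz (by simpa using (hr z hz).1)
  have hne : ∀ x, r * E x ≠ 0 := fun x => mul_ne_zero hr0 (hE x).ne'
  constructor
  · obtain ⟨h1, h2⟩ := hr π ⟨pi_pos.le, le_rfl⟩
    rw [h1, h2] at hβ
    have : r * E π * sin (θ π + β) = 0 := by rw [sin_add]; linarith
    exact (mul_eq_zero.1 this).resolve_left (hne π)
  · intro x hx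
    rw [(hr x hx).1, mul_eq_zero]
    simp only [hne x, false_or]

theorem isEigenvalue_of_sin_pruferAngle {q θ : ℝ → ℝ} {α β μ : ℝ}
    (hq : IntervalIntegrable q volume 0 π)
    (hθ0 : θ 0 = π - α) (hθ : IsPruferAngle π (fun t => μ - q t - 1) θ)
    (h : sin (θ π + β) = 0) : IsEigenvalue q α β μ := by
  obtain ⟨E, hE, h1, h2⟩ := hθ.exists_solution pi_pos.le
    ((intervalIntegrable_const.sub hq).sub intervalIntegrable_const)
  refine ⟨fun x => E x * sin (θ x), fun x => E x * cos (θ x),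
    ⟨h1.continuousOn pi_pos.le, h2.continuousOn pi_pos.le, h1.2, fun x hx => ?_⟩, ?_, ?_, ?_⟩
  · have h3 : ∀ t, (q t - μ) * (E t * sin (θ t)) = -(1 + (μ - q t - 1)) * (E t * sin (θ t)) :=
      fun t => by ring
    simp only [h3]
    exact h2.2 x hx
  · obtain ⟨x, hx, hs⟩ := hθ.exists_sin_ne_zero pi_pos
    exact ⟨x, hx, mul_ne_zero (hE x).ne' hs⟩
  · simp only [hθ0, sin_pi_sub, cos_pi_sub]
    ring
  · rw [sin_add] at h
    linear_combination E π * h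

theorem StrictMono.eq_self_of_lower_range {κ : ℕ → ℕ} (hκ : StrictMono κ)
    (h : ∀ l, ∀ i < κ l, ∃ m, κ m = i) (n : ℕ) : κ n = n := by
  induction n using Nat.strong_induction_on with
  | _ n ih =>
    by_contra hne
    obtain ⟨m, hm⟩ := h n n (lt_of_le_of_ne (hκ.le_apply) (Ne.symm hne))
    have hmn : m ≤ n := hm ▸ hκ.le_apply
    rcases hmn.eq_or_lt with rfl | hlt
    · exact hne hm
    · exact hlt.ne ((ih m hlt).symm.trans hm)

/-- The Prüfer angle of the `n`-th eigenvalue ends at `(n + 1) π - β`. -/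
theorem pruferAngle_eigenvalue {q : ℝ → ℝ} (hq : IntervalIntegrable q volume 0 π)
    {α β : ℝ} (hα : α ∈ Ioc (0:ℝ) π) (hβ : β ∈ Ico (0:ℝ) π)
    {M : ℕ → ℝ} (hmono : StrictMono M) (henum : ∀ μ : ℝ, IsEigenvalue q α β μ ↔ ∃ n : ℕ, μ = M n)
    {θ : ℝ → ℝ → ℝ} (hθ0 : ∀ μ, θ μ 0 = π - α)
    (hθ : ∀ μ, IsPruferAngle π (fun t => μ - q t - 1) (θ μ)) (n : ℕ) :
    θ (M n) π = ((n : ℝ) + 1) * π - β := by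
  have hb := pi_pos.le
  have hp : ∀ μ : ℝ, IntervalIntegrable (fun t => μ - q t - 1) volume 0 π := fun μ =>
    (intervalIntegrable_const.sub hq).sub intervalIntegrable_const
  have hshift : ∀ μ ν : ℝ, IsPruferAngle π (fun t => (μ - q t - 1) + (ν - μ)) (θ ν) := by
    intro μ ν
    convert hθ ν using 2
    ring
  have hT : StrictMono fun μ => θ μ π := fun μ ν hμν =>
    (hθ μ).lt_of_lt pi_pos (hp μ) (hshift μ ν) (by rw [hθ0, hθ0]) (sub_pos.2 hμν)
  have hTc : Continuous fun μ => θ μ π := by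
    refine continuous_iff_continuousAt.2 fun μ => continuousAt_of_locally_lipschitz one_pos
      (exp (∫ t in (0:ℝ)..π, |μ - q t - 1|) * (exp (∫ t in (0:ℝ)..π, |μ - q t - 1|) * π))
      fun ν _ => ?_
    exact (hθ μ).abs_sub_le hb (hp μ) (hshift μ ν) (by rw [hθ0, hθ0])
  have hsmall : ∀ ε > 0, ∃ μ, θ μ π < ε := by
    intro ε hε
    obtain ⟨k, hk⟩ := exists_isPruferAngle_lt (hp 0) (sub_nonneg.2 hα.2) (by linarith [hα.1])
      (θ := fun k => θ (-(k : ℝ))) (fun k => hθ0 _) (fun k => by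
        convert hθ (-(k : ℝ)) using 2
        ring) hε
    exact ⟨_, hk⟩
  have hpos : ∀ μ, 0 < θ μ π := by
    intro μ
    have := (hθ μ).int_mul_pi_lt hb (hp μ) (m := 0) (a := 0) (x := π) ⟨le_rfl, hb⟩ ⟨hb, le_rfl⟩
      pi_pos (by rw [hθ0]; simpa using hα.2)
    simpa using this
  have hκ : ∀ m, ∃ j : ℕ, θ (M m) π = ((j : ℝ) + 1) * π - β := by
    intro m
    obtain ⟨y, y', hy⟩ := (henum (M m)).2 ⟨m, rfl⟩
    obtain ⟨k, hk⟩ := sin_eq_zero_iff.1 (hy.sin_pruferAngle hq (hθ0 _) (hθ _)).1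
    have hk0 : 0 < k := by
      have h1 : 0 < (k : ℝ) * π := by rw [hk]; linarith [hpos (M m), hβ.1]
      exact_mod_cast pos_of_mul_pos_left h1 hb
    obtain ⟨j, rfl⟩ : ∃ j : ℕ, k = j + 1 := ⟨(k - 1).toNat, by omega⟩
    refine ⟨j, ?_⟩
    push_cast at hk
    linarith
  choose κ hκ using hκ
  have hκmono : StrictMono κ := by
    intro i j hij
    have h1 : θ (M i) π < θ (M j) π := hT (hmono hij)
    rw [hκ, hκ] at h1
    have h2 : ((κ i : ℝ) + 1) * π < ((κ j : ℝ) + 1) * π := by linarith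
    have h3 := lt_of_mul_lt_mul_right h2 hb
    exact_mod_cast (by linarith : (κ i : ℝ) < κ j)
  have hlower : ∀ l, ∀ i < κ l, ∃ m, κ m = i := by
    intro l i hi
    have hv : 0 < ((i : ℝ) + 1) * π - β := by
      nlinarith [pi_pos, hβ.2, (Nat.cast_nonneg i : (0:ℝ) ≤ i)]
    obtain ⟨μ₀, hμ₀⟩ := hsmall _ hv
    obtain ⟨μ, hμ : θ μ π = _⟩ := mem_range_of_exists_le_of_exists_ge hTc ⟨μ₀, hμ₀.le⟩
      ⟨M l, by
        change _ ≤ θ (M l) π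
        rw [hκ]
        have : (i : ℝ) ≤ κ l := by exact_mod_cast hi.le
        gcongr⟩
    have hev : IsEigenvalue q α β μ := isEigenvalue_of_sin_pruferAngle hq (hθ0 μ) (hθ μ) (by
      rw [hμ, sub_add_cancel]
      exact_mod_cast sin_nat_mul_pi (i + 1))
    obtain ⟨m, rfl⟩ := (henum μ).1 hev
    refine ⟨m, ?_⟩
    rw [hκ] at hμ
    have h2 : ((κ m : ℝ) + 1) * π = ((i : ℝ) + 1) * π := by linarith
    have h3 := mul_right_cancel₀ pi_ne_zero h2
    exact_mod_cast (by linarith : (κ m : ℝ) = i)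
  rw [hκ, hκmono.eq_self_of_lower_range hlower]

theorem le_int_mul_pi_iff {c : ℝ} (h0 : 0 < c) (hc : c ≤ π) (m : ℤ) : c ≤ m * π ↔ 1 ≤ m := by
  constructor
  · intro h
    have : (0:ℝ) < m := pos_of_mul_pos_left (h0.trans_le h) pi_pos.le
    have : 0 < m := by exact_mod_cast this
    omega
  · intro h
    have : (1:ℝ) ≤ m := by exact_mod_cast h
    nlinarith [pi_pos]

theorem int_mul_pi_le_iff {c : ℝ} (h0 : 0 ≤ c) (hc : c < π) (m k : ℤ) :
    m * π ≤ k * π + c ↔ m ≤ k := by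
  constructor
  · intro h
    have h1 : (m : ℝ) * π < (k + 1) * π := by linarith
    have h2 := lt_of_mul_lt_mul_right h1 pi_pos.le
    have : m < k + 1 := by exact_mod_cast h2
    omega
  · intro h
    have : (m : ℝ) ≤ k := by exact_mod_cast h
    nlinarith [pi_pos]

/-- Zero count of the `n`-th eigenfunction on the closed interval `[0, π]`:
`n + 2` zeros under double Dirichlet conditions (`α = π`, `β = 0`), `n + 1` zeros when
exactly one of the endpoint conditions is Dirichlet, and `n` zeros otherwise. -/
theorem eigenfunction_zero_count_closed_interval
    (q : ℝ → ℝ) (hq : IntervalIntegrable q volume 0 π)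
    (α β : ℝ) (hα : α ∈ Ioc (0:ℝ) π) (hβ : β ∈ Ico (0:ℝ) π)
    (M : ℕ → ℝ) (hmono : StrictMono M)
    (henum : ∀ μ : ℝ, IsEigenvalue q α β μ ↔ ∃ n : ℕ, μ = M n) :
    ∀ (n : ℕ) (y y' : ℝ → ℝ), IsEigenpair q α β (M n) y y' →
      ((α = π ∧ β = 0) → ({x ∈ Icc (0:ℝ) π | y x = 0}).ncard = n + 2) ∧
      ((α = π ∧ β ∈ Ioo (0:ℝ) π) → ({x ∈ Icc (0:ℝ) π | y x = 0}).ncard = n + 1) ∧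
      ((β = 0 ∧ α ∈ Ioo (0:ℝ) π) → ({x ∈ Icc (0:ℝ) π | y x = 0}).ncard = n + 1) ∧
      ((α ∈ Ioo (0:ℝ) π ∧ β ∈ Ioo (0:ℝ) π) → ({x ∈ Icc (0:ℝ) π | y x = 0}).ncard = n) := by
  intro n y y' hy
  have hp : ∀ μ : ℝ, IntervalIntegrable (fun t => μ - q t - 1) volume 0 π := fun μ =>
    (intervalIntegrable_const.sub hq).sub intervalIntegrable_const
  choose θ hθ0 hθ using fun μ : ℝ => exists_isPruferAngle pi_pos.le (hp μ) (π - α)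
  have hend := pruferAngle_eigenvalue hq hα hβ hmono henum hθ0 hθ n
  have hset : {x ∈ Icc (0:ℝ) π | y x = 0} = {x ∈ Icc (0:ℝ) π | sin (θ (M n) x) = 0} := by
    ext x
    exact and_congr_right ((hy.sin_pruferAngle hq (hθ0 _) (hθ _)).2 x)
  have hcount : ∀ lo hi : ℤ, (∀ m : ℤ, π - α ≤ m * π ↔ lo ≤ m) →
      (∀ m : ℤ, m * π ≤ ((n : ℝ) + 1) * π - β ↔ m ≤ hi) →
      ({x ∈ Icc (0:ℝ) π | y x = 0}).ncard = (hi + 1 - lo).toNat := by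
    intro lo hi hlo hhi
    rw [hset]
    refine (hθ (M n)).ncard_sin_eq_zero pi_pos.le (hp _) fun m => ?_
    rw [hθ0, hend, hlo, hhi]
  have hlo0 : α = π → ∀ m : ℤ, π - α ≤ m * π ↔ 0 ≤ m := by
    intro h m
    rw [h, sub_self, mul_nonneg_iff_of_pos_right pi_pos]
    exact Int.cast_nonneg_iff
  have hlo1 : α ∈ Ioo 0 π → ∀ m : ℤ, π - α ≤ m * π ↔ 1 ≤ m := fun h m =>
    le_int_mul_pi_iff (sub_pos.2 h.2) (by linarith [h.1]) m
  have hhi0 : β = 0 → ∀ m : ℤ, m * π ≤ ((n : ℝ) + 1) * π - β ↔ m ≤ (n : ℤ) + 1 := by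
    intro h m
    rw [← int_mul_pi_le_iff le_rfl pi_pos, h]
    push_cast
    simp
  have hhi1 : β ∈ Ioo 0 π → ∀ m : ℤ, m * π ≤ ((n : ℝ) + 1) * π - β ↔ m ≤ (n : ℤ) := by
    intro h m
    rw [← int_mul_pi_le_iff (sub_nonneg.2 h.2.le) (by linarith [h.1] : π - β < π)]
    push_cast
    rw [show ((n : ℝ) + 1) * π - β = n * π + (π - β) by ring]
  refine ⟨fun h => ?_, fun h => ?_, fun h => ?_, fun h => ?_⟩
  · rw [hcount _ _ (hlo0 h.1) (hhi0 h.2)]; omega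
  · rw [hcount _ _ (hlo0 h.1) (hhi1 h.2)]; omega
  · rw [hcount _ _ (hlo1 h.2) (hhi0 h.1)]; omega
  · rw [hcount _ _ (hlo1 h.1) (hhi1 h.2)]; omega
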